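/- (Theorem 2.) Let occ : ℤ³ → S be an occupancy map and let Z ∈ ℤ be such that every voxel beyond the spatial extent of the environment in the z⁺ direction is unknown, i.e., occ(x, y, z') = unknown for all x, y, z' ∈ ℤ with z' > Z. Let q = (x, y, z) be a voxel with z ≤ Z, and assume that no boundary voxel is found along the search direction z⁺ within the extent of the environment, i.e., for every integer i with 0 ≤ i ≤ Z − z the voxel (x, y, z + i) is not a boundary voxel. Then occ(q) = unknown. -/

import Mathlib

inductive OccState : Type
  | free | occupied | unknown
deriving DecidableEq

abbrev Voxel := ℤ × ℤ × ℤ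

/-- Two voxels are 6-neighbors iff their ℓ¹ distance is 1. -/
def sixNbr (m n : Voxel) : Prop :=
  |m.1 - n.1| + |m.2.1 - n.2.1| + |m.2.2 - n.2.2| = 1

/-- Boundary interior voxel: free, with a 6-neighbor that is unknown or occupied. -/
def bdInt (occ : Voxel → OccState) (n : Voxel) : Prop :=
  occ n = OccState.free ∧
    ∃ m, sixNbr m n ∧ (occ m = OccState.unknown ∨ occ m = OccState.occupied)

/-- Boundary exterior (unknown) voxel: unknown, with a free 6-neighbor. -/
def bdUkn (occ : Voxel → OccState) (n : Voxel) : Prop :=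
  occ n = OccState.unknown ∧ ∃ m, sixNbr m n ∧ occ m = OccState.free

/-- Boundary exterior (occupied) voxel: any occupied voxel. -/
def bdOcc (occ : Voxel → OccState) (n : Voxel) : Prop :=
  occ n = OccState.occupied

/-- Boundary voxel. -/
def bdVoxel (occ : Voxel → OccState) (n : Voxel) : Prop :=
  bdInt occ n ∨ bdUkn occ n ∨ bdOcc occ n

/-- An axis direction: exactly one nonzero coordinate, equal to ±1 (ℓ¹ norm 1). -/
def axisDir (e : Voxel) : Prop :=
  |e.1| + |e.2.1| + |e.2.2| = 1

theorem sixNbr_add_one (x y w : ℤ) : sixNbr (x, y, w + 1) (x, y, w) := by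
  simp [sixNbr]

/-- A non-boundary voxel below an unknown voxel is itself unknown. -/
theorem eq_unknown_of_not_bdVoxel {occ : Voxel → OccState} {x y w : ℤ}
    (hw : ¬ bdVoxel occ (x, y, w)) (habove : occ (x, y, w + 1) = OccState.unknown) :
    occ (x, y, w) = OccState.unknown := by
  cases h : occ (x, y, w) with
  | free => exact absurd (Or.inl ⟨h, _, sixNbr_add_one x y w, Or.inl habove⟩) hw
  | occupied => exact absurd (Or.inr (Or.inr h)) hw
  | unknown => rfl

theorem stmt5 (occ : Voxel → OccState) (Z : ℤ)
    (hout : ∀ x y z' : ℤ, Z < z' → occ (x, y, z') = OccState.unknown)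
    (x y z : ℤ) (hz : z ≤ Z)
    (hnb : ∀ i : ℤ, 0 ≤ i → i ≤ Z - z → ¬ bdVoxel occ (x, y, z + i)) :
    occ (x, y, z) = OccState.unknown := by
  have key : ∀ k : ℕ, ∀ w : ℤ, z ≤ w → Z + 1 - w ≤ k → occ (x, y, w) = OccState.unknown := by
    intro k
    induction k with
    | zero => exact fun w _ hk => hout x y w (by omega)
    | succ k ih =>
      intro w hw hk
      rcases lt_or_ge Z w with hZ | hZ
      · exact hout x y w hZ
      · refine eq_unknown_of_not_bdVoxel ?_ (ih (w + 1) (by omega) (by omega))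
        simpa using hnb (w - z) (by omega) (by omega)
  exact key (Z + 1 - z).toNat z le_rfl (by omega)
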